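/- If K and L are bifix-free regular languages with m and n quotients respectively, where m, n ≥ 4, then the difference K \ L has at most mn − (2m + 3n − 9) distinct quotients. -/

import Mathlib

def lq {α : Type*} (L : Set (List α)) (w : List α) : Set (List α) := {x | w ++ x ∈ L}

def PrefixFree {α : Type*} (L : Set (List α)) : Prop := ∀ u ∈ L, ∀ v ∈ L, u <+: v → u = v
def SuffixFree {α : Type*} (L : Set (List α)) : Prop := ∀ u ∈ L, ∀ v ∈ L, u <:+ v → u = v
def FactorFree {α : Type*} (L : Set (List α)) : Prop := ∀ u ∈ L, ∀ v ∈ L, u <:+: v → u = v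
def SubwordFree {α : Type*} (L : Set (List α)) : Prop := ∀ u ∈ L, ∀ v ∈ L, List.Sublist u v → u = v

theorem lq_nil {α : Type*} (L : Set (List α)) : lq L [] = L := rfl

theorem lq_diff {α : Type*} (K L : Set (List α)) (w : List α) :
    lq (K \ L) w = lq K w \ lq L w := rfl

theorem PrefixFree.lq_eq_singleton_nil {α : Type*} {L : Set (List α)} (h : PrefixFree L)
    {w : List α} (hw : w ∈ L) : lq L w = {[]} := by
  ext x
  refine ⟨fun hx => ?_, ?_⟩
  · simpa using h w hw (w ++ x) hx (List.prefix_append w x)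
  · rintro rfl
    simpa [lq] using hw

theorem SuffixFree.eq_nil_of_lq_eq {α : Type*} {L : Set (List α)} (h : SuffixFree L)
    (hne : L.Nonempty) {w : List α} (hw : lq L w = L) : w = [] := by
  obtain ⟨x, hx⟩ := hne
  have hwx : w ++ x ∈ L := by rwa [← hw] at hx
  simpa using h x hx (w ++ x) hwx (List.suffix_append w x)

theorem exists_mem_ne_nil_of_two_lt_ncard {α : Type*} {L : Set (List α)}
    (h : 2 < (Set.range (lq L)).ncard) : ∃ w ∈ L, w ≠ [] := by
  by_contra! hL
  have hsub : Set.range (lq L) ⊆ {∅, {[]}} := by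
    rintro _ ⟨w, rfl⟩
    refine Set.subset_singleton_iff_eq.mp fun x hx => ?_
    exact (List.append_eq_nil_iff.mp (hL _ hx)).2
  have h1 := Set.ncard_le_ncard hsub
  have h2 := Set.ncard_pair (Set.singleton_ne_empty ([] : List α)).symm
  omega

theorem PrefixFree.nil_notMem {α : Type*} {L : Set (List α)} (h : PrefixFree L)
    {w : List α} (hw : w ∈ L) (hw0 : w ≠ []) : [] ∉ L := fun h0 =>
  hw0 (h [] h0 w hw List.nil_prefix).symm

theorem PrefixFree.empty_mem_range_lq {α : Type*} {L : Set (List α)} (h : PrefixFree L)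
    {w : List α} (hw : w ∈ L) (hw0 : w ≠ []) : ∅ ∈ Set.range (lq L) := by
  refine ⟨w ++ w, Set.eq_empty_of_forall_notMem fun x hx => hw0 ?_⟩
  have hx' : w ++ (w ++ x) ∈ L := by simpa [lq] using hx
  have h' := congrArg List.length (h w hw _ hx' (List.prefix_append w _))
  simp only [List.length_append] at h'
  exact List.length_eq_zero_iff.mp (by omega)

theorem PrefixFree.range_lq_diff_subset {α : Type*} {K L : Set (List α)}
    (hKp : PrefixFree K) (hKs : SuffixFree K) (hLp : PrefixFree L) (hLs : SuffixFree L)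
    (hK : K.Nonempty) {v : List α} (hv : v ∈ L) (hv0 : v ≠ []) :
    Set.range (lq (K \ L)) ⊆ {K \ L, ∅, {[]}} ∪
      Set.image2 (· \ ·) (Set.range (lq K) \ {K, ∅, {[]}}) (Set.range (lq L) \ {L, {[]}}) := by
  rintro _ ⟨w, rfl⟩
  rw [lq_diff]
  by_cases hw : w = []
  · subst hw
    exact Or.inl (Or.inl rfl)
  have hKw : lq K w ≠ K := fun h => hw (hKs.eq_nil_of_lq_eq hK h)
  have hLw : lq L w ≠ L := fun h => hw (hLs.eq_nil_of_lq_eq ⟨v, hv⟩ h)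
  by_cases hsub : lq K w ⊆ {[]}
  · exact Or.inl (Or.inr (Set.subset_singleton_iff_eq.mp (Set.sdiff_subset.trans hsub)))
  have hmem : lq K w ∈ Set.range (lq K) \ {K, ∅, {[]}} := by
    refine ⟨⟨w, rfl⟩, ?_⟩
    rintro (h | h)
    · exact hKw h
    · exact hsub (Set.subset_singleton_iff_eq.mpr h)
  right
  by_cases hLe : lq L w = {[]}
  · refine ⟨_, hmem, ∅, ⟨hLp.empty_mem_range_lq hv hv0, ?_⟩, ?_⟩
    · rintro (h | h)
      · exact (h ▸ hv : v ∈ (∅ : Set (List α)))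
      · exact (Set.singleton_ne_empty _).symm h
    · have hnil : [] ∉ lq K w := fun h0 => hsub
        (hKp.lq_eq_singleton_nil (by simpa [lq] using h0)).subset
      simp [hLe, hnil]
  · refine ⟨_, hmem, lq L w, ⟨⟨w, rfl⟩, ?_⟩, rfl⟩
    rintro (h | h)
    · exact hLw h
    · exact hLe h

theorem bifixFree_diff_quotient_complexity {α : Type*} (K L : Set (List α)) (m n : ℕ) (hm : 4 ≤ m) (hn : 4 ≤ n)
    (hKp : PrefixFree K) (hKs : SuffixFree K) (hLp : PrefixFree L) (hLs : SuffixFree L)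
    (hKfin : (Set.range (lq K)).Finite) (hLfin : (Set.range (lq L)).Finite)
    (hKm : (Set.range (lq K)).ncard = m) (hLn : (Set.range (lq L)).ncard = n) :
    (Set.range (lq (K \ L))).Finite ∧
    (Set.range (lq (K \ L))).ncard ≤ m * n - (2 * m + 3 * n - 9) := by
  obtain ⟨u, hu, hu0⟩ := exists_mem_ne_nil_of_two_lt_ncard (L := K) (by omega)
  obtain ⟨v, hv, hv0⟩ := exists_mem_ne_nil_of_two_lt_ncard (L := L) (by omega)
  have hsub := hKp.range_lq_diff_subset hKs hLp hLs ⟨u, hu⟩ hv hv0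
  have hKne : K ≠ {[]} := fun h => hKp.nil_notMem hu hu0 (h ▸ rfl)
  have hLne : L ≠ {[]} := fun h => hLp.nil_notMem hv hv0 (h ▸ rfl)
  have hK0 : K ≠ ∅ := Set.Nonempty.ne_empty ⟨u, hu⟩
  have hA : (Set.range (lq K) \ {K, ∅, {[]}}).ncard = m - 3 := by
    rw [Set.ncard_sdiff, hKm, Set.ncard_eq_three.mpr
      ⟨_, _, _, hK0, hKne, (Set.singleton_ne_empty _).symm, rfl⟩]
    rintro _ (rfl | rfl | rfl)
    exacts [⟨[], lq_nil _⟩, hKp.empty_mem_range_lq hu hu0, ⟨u, hKp.lq_eq_singleton_nil hu⟩]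
  have hB : (Set.range (lq L) \ {L, {[]}}).ncard = n - 2 := by
    rw [Set.ncard_sdiff, hLn, Set.ncard_pair hLne]
    rintro _ (rfl | rfl)
    exacts [⟨[], lq_nil _⟩, ⟨v, hLp.lq_eq_singleton_nil hv⟩]
  have hAfin := hKfin.sdiff (t := {K, ∅, {[]}})
  have hBfin := hLfin.sdiff (t := {L, {[]}})
  have hfin := (Set.toFinite {K \ L, ∅, {[]}}).union (hAfin.image2 (· \ ·) hBfin)
  refine ⟨hfin.subset hsub, (Set.ncard_le_ncard hsub hfin).trans
    ((Set.ncard_union_le _ _).trans ?_)⟩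
  have h3 : ({K \ L, ∅, {[]}} : Set (Set (List α))).ncard ≤ 3 :=
    (Set.ncard_insert_le _ _).trans (Nat.succ_le_succ
      (Set.ncard_pair (Set.singleton_ne_empty ([] : List α)).symm).le)
  have himg : (Set.image2 (· \ ·) (Set.range (lq K) \ {K, ∅, {[]}})
      (Set.range (lq L) \ {L, {[]}})).ncard ≤ (m - 3) * (n - 2) := by
    rw [← hA, ← hB, ← Set.ncard_prod, ← Set.image_uncurry_prod]
    exact Set.ncard_image_le (hAfin.prod hBfin)
  refine (Nat.add_le_add h3 himg).trans (Nat.le_sub_of_add_le ?_)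
  obtain ⟨a, rfl⟩ := Nat.exists_eq_add_of_le hm
  obtain ⟨b, rfl⟩ := Nat.exists_eq_add_of_le hn
  have e1 : 4 + a - 3 = a + 1 := by omega
  have e2 : 4 + b - 2 = b + 2 := by omega
  have e3 : 2 * (4 + a) + 3 * (4 + b) - 9 = 2 * a + 3 * b + 11 := by omega
  rw [e1, e2, e3]
  exact le_of_eq (by ring)
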